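/- arXiv:2603.27088 — 6 statements merged into one kernel-verified Lean document; each statement's English description precedes it below -/
import Mathlib

section
/- Let Λ : ℝ × (0,∞) → (0,1) satisfy Assumption 1, suppose γ(A) > 0, and let T : ℝ^d → ℝ be γ-integrable (∫_{ℝ^d} |T| dγ < ∞). Then the difference between the expectation of T under the truncated measure μ_f and its expectation under the smoothed measure μ_Δ converges to zero as Δ → 0⁺, i.e. lim_{Δ→0⁺} | ∫ T dμ_f − ∫ T dμ_Δ | = 0. -/
open MeasureTheory ProbabilityTheory Filter Topology Set

/-- The standard Gaussian probability measure on `ℝ^d` (the `d`-fold product of `N(0,1)`). -/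
noncomputable def stdGaussian (d : ℕ) : Measure (Fin d → ℝ) :=
  Measure.pi fun _ => gaussianReal 0 1

theorem tendsto_prod_indicator_of_tendsto {α ι : Type*} [Fintype ι] {S : ι → α → ℝ}
    {Λ : ℝ → ℝ → ℝ} {l : Filter ℝ}
    (hnonneg : ∀ x : ℝ, 0 ≤ x → Tendsto (fun Δ => Λ x Δ) l (𝓝 1))
    (hneg : ∀ x : ℝ, x < 0 → Tendsto (fun Δ => Λ x Δ) l (𝓝 0)) (z : α) :
    Tendsto (fun Δ => ∏ i, Λ (S i z) Δ) l
      (𝓝 ({z | ∀ i, 0 ≤ S i z}.indicator (fun _ => (1 : ℝ)) z)) := by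
  classical
  have hprod : Tendsto (fun Δ => ∏ i, Λ (S i z) Δ) l
      (𝓝 (∏ i, if 0 ≤ S i z then (1 : ℝ) else 0)) := by
    refine tendsto_finsetProd _ fun i _ => ?_
    split_ifs with h
    · exact hnonneg _ h
    · exact hneg _ (not_le.mp h)
  convert hprod using 2
  simp [Finset.prod_ite_zero, Set.indicator_apply]

theorem tendsto_integral_mul_of_tendsto_indicator {α : Type*} [MeasurableSpace α]
    {μ : Measure α} {A : Set α} (hA : MeasurableSet A) {P : ℝ → α → ℝ} {l : Filter ℝ}
    [l.IsCountablyGenerated] (hmeas : ∀ᶠ Δ in l, Measurable (P Δ))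
    (hbound : ∀ᶠ Δ in l, ∀ z, |P Δ z| ≤ 1)
    (hlim : ∀ z, Tendsto (fun Δ => P Δ z) l (𝓝 (A.indicator (fun _ => (1 : ℝ)) z)))
    {f : α → ℝ} (hf : Integrable f μ) :
    Tendsto (fun Δ => ∫ z, P Δ z * f z ∂μ) l (𝓝 (∫ z in A, f z ∂μ)) := by
  have h : Tendsto (fun Δ => ∫ z, P Δ z * f z ∂μ) l
      (𝓝 (∫ z, A.indicator (fun _ => (1 : ℝ)) z * f z ∂μ)) := by
    refine tendsto_integral_filter_of_dominated_convergence (fun z => |f z|) ?_ ?_ hf.abs ?_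
    · filter_upwards [hmeas] with Δ hΔ
      exact hΔ.aestronglyMeasurable.mul hf.aestronglyMeasurable
    · filter_upwards [hbound] with Δ hΔ
      refine ae_of_all _ fun z => ?_
      rw [Real.norm_eq_abs, abs_mul]
      exact mul_le_of_le_one_left (abs_nonneg _) (hΔ z)
    · exact ae_of_all _ fun z => (hlim z).mul_const _
  convert h using 2
  rw [← integral_indicator hA]
  congr 1 with z
  by_cases hz : z ∈ A <;> simp [hz]

/-- **Proposition 1.** If the regularisation function `Λ` satisfies Assumption 1, the constraint
set `A` has positive Gaussian measure, and `T` is `γ`-integrable, then the expectation of `T`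
under the truncated measure `μf` and under the smoothed measure `μΔ Δ` converge to each other
as `Δ → 0⁺`. -/
theorem soft_sign_expectation_convergence
    (d s : ℕ) (hd : 1 ≤ d) (hs : 1 ≤ s)
    (S : Fin s → (Fin d → ℝ) → ℝ) (hS : ∀ ℓ, Measurable (S ℓ))
    (Λ : ℝ → ℝ → ℝ)
    (hrange : ∀ x Δ : ℝ, 0 < Δ → Λ x Δ ∈ Set.Ioo (0 : ℝ) 1)
    (hmeas : ∀ Δ : ℝ, 0 < Δ → Measurable fun z => ∏ ℓ : Fin s, Λ (S ℓ z) Δ)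
    -- Assumption 1:
    (h1 : ∀ Δ : ℝ, 0 < Δ → Tendsto (fun x => Λ x Δ) atTop (𝓝 1))
    (h2 : ∀ Δ : ℝ, 0 < Δ → Tendsto (fun x => Λ x Δ) atBot (𝓝 0))
    (h3 : ∀ x : ℝ, 0 ≤ x → Tendsto (fun Δ => Λ x Δ) (𝓝[>] 0) (𝓝 1))
    (h4 : ∀ x : ℝ, x < 0 → Tendsto (fun Δ => Λ x Δ) (𝓝[>] 0) (𝓝 0))
    (h5 : ∃ K : ℝ, 0 < K ∧ ∀ x Δ : ℝ, 0 < Δ →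
      |Λ x Δ - (if 0 ≤ x then (1 : ℝ) else 0)| ≤ K)
    -- the constraint set and its positive Gaussian measure:
    (A : Set (Fin d → ℝ)) (hA : A = {z | ∀ ℓ : Fin s, 0 ≤ S ℓ z})
    (hApos : 0 < stdGaussian d A)
    -- the integrand:
    (T : (Fin d → ℝ) → ℝ) (hT : Integrable T (stdGaussian d))
    -- smoothed normalising constant and smoothed probability measure:
    (C : ℝ → ℝ)
    (hC : ∀ Δ : ℝ, C Δ = ∫ z, (∏ ℓ : Fin s, Λ (S ℓ z) Δ) ∂(stdGaussian d))
    (μΔ : ℝ → Measure (Fin d → ℝ))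
    (hμΔ : ∀ Δ : ℝ, μΔ Δ = (stdGaussian d).withDensity
      (fun z => ENNReal.ofReal ((C Δ)⁻¹ * ∏ ℓ : Fin s, Λ (S ℓ z) Δ)))
    -- the truncated probability measure:
    (μf : Measure (Fin d → ℝ))
    (hμf : μf = (stdGaussian d A)⁻¹ • (stdGaussian d).restrict A) :
    Tendsto (fun Δ => |(∫ z, T z ∂μf) - ∫ z, T z ∂(μΔ Δ)|) (𝓝[>] 0) (𝓝 0) := by
  have : IsProbabilityMeasure (stdGaussian d) := by
    unfold _root_.stdGaussian
    infer_instance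
  have hAmeas : MeasurableSet A := by
    rw [hA, Set.ofPred_forall]
    exact MeasurableSet.iInter fun ℓ => measurableSet_le measurable_const (hS ℓ)
  have hpos : ∀ᶠ Δ : ℝ in 𝓝[>] 0, 0 < Δ := self_mem_nhdsWithin
  have hP0 : ∀ Δ : ℝ, 0 < Δ → ∀ z, 0 ≤ ∏ ℓ : Fin s, Λ (S ℓ z) Δ := fun Δ hΔ z =>
    Finset.prod_nonneg fun ℓ _ => (hrange _ _ hΔ).1.le
  have hlim : ∀ f : (Fin d → ℝ) → ℝ, Integrable f (stdGaussian d) →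
      Tendsto (fun Δ => ∫ z, (∏ ℓ : Fin s, Λ (S ℓ z) Δ) * f z ∂(stdGaussian d)) (𝓝[>] 0)
        (𝓝 (∫ z in A, f z ∂(stdGaussian d))) := fun f hf => by
    refine tendsto_integral_mul_of_tendsto_indicator hAmeas (hpos.mono hmeas) ?_ ?_ hf
    · filter_upwards [hpos] with Δ hΔ z
      rw [abs_of_nonneg (hP0 Δ hΔ z)]
      exact Finset.prod_le_one (fun ℓ _ => (hrange _ _ hΔ).1.le) fun ℓ _ => (hrange _ _ hΔ).2.le
    · rw [hA]
      exact tendsto_prod_indicator_of_tendsto h3 h4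
  have hClim : Tendsto C (𝓝[>] 0) (𝓝 ((stdGaussian d).real A)) := by
    simpa [← hC] using hlim (fun _ => 1) (integrable_const 1)
  have hA0 : (stdGaussian d).real A ≠ 0 :=
    (ENNReal.toReal_pos hApos.ne' (measure_ne_top _ _)).ne'
  have hμΔlim : Tendsto (fun Δ => ∫ z, T z ∂(μΔ Δ)) (𝓝[>] 0) (𝓝 (∫ z, T z ∂μf)) := by
    have hf : ∫ z, T z ∂μf = ((stdGaussian d).real A)⁻¹ * ∫ z in A, T z ∂(stdGaussian d) := by
      rw [hμf, integral_smul_measure, ENNReal.toReal_inv, smul_eq_mul, Measure.real]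
    rw [hf]
    refine ((hClim.inv₀ hA0).mul (hlim T hT)).congr' ?_
    filter_upwards [hpos] with Δ hΔ
    have hC0 : 0 ≤ C Δ := hC Δ ▸ integral_nonneg (hP0 Δ hΔ)
    rw [hμΔ, integral_withDensity_eq_integral_toReal_smul
      ((hmeas Δ hΔ).const_mul _).ennreal_ofReal (ae_of_all _ fun _ => ENNReal.ofReal_lt_top),
      ← integral_const_mul]
    refine integral_congr_ae (ae_of_all _ fun z => ?_)
    simp only [smul_eq_mul]
    rw [ENNReal.toReal_ofReal (mul_nonneg (inv_nonneg.mpr hC0) (hP0 Δ hΔ z)), mul_assoc]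
  simpa using (hμΔlim.const_sub (∫ z, T z ∂μf)).abs
end

section
/- Let Λ be the logistic regularisation function. Suppose γ({z ∈ ℝ^d : S_ℓ(z) = 0 for some ℓ}) = 0 and γ(A) > 0. Then for every z ∈ ℝ^d such that S_ℓ(z) ≠ 0 for all ℓ, the smoothed density converges pointwise to the truncated density as Δ → 0⁺: C_Δ^{-1} ∏_{ℓ=1}^s Λ(S_ℓ(z), Δ) → 1_A(z)/γ(A). -/
open MeasureTheory ProbabilityTheory Filter Topology Set

/-- Away from the origin the logistic function converges to the Heaviside function as the
smoothing parameter tends to `0` from above. -/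
lemma tendsto_logistic_nhdsGT_zero {x : ℝ} (hx : x ≠ 0) :
    Tendsto (fun Δ : ℝ => (1 + Real.exp (-x / Δ))⁻¹) (𝓝[>] 0) (𝓝 (if 0 ≤ x then 1 else 0)) := by
  simp only [div_eq_mul_inv]
  rcases hx.lt_or_gt with h | h
  · rw [if_neg h.not_ge]
    exact tendsto_inv_atTop_zero.comp <| tendsto_atTop_add_const_left _ _ <|
      Real.tendsto_exp_atTop.comp <| tendsto_inv_nhdsGT_zero.const_mul_atTop (neg_pos.2 h)
  · rw [if_pos h.le]
    have hexp : Tendsto (fun Δ : ℝ => Real.exp (-x * Δ⁻¹)) (𝓝[>] 0) (𝓝 0) :=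
      Real.tendsto_exp_atBot.comp <|
        tendsto_inv_nhdsGT_zero.const_mul_atTop_of_neg (neg_neg_of_pos h)
    simpa using (hexp.const_add 1).inv₀ (by norm_num)

lemma tendsto_prod_logistic_nhdsGT_zero {α ι : Type*} [Fintype ι] {S : ι → α → ℝ} {z : α}
    (hz : ∀ i, S i z ≠ 0) :
    Tendsto (fun Δ : ℝ => ∏ i, (1 + Real.exp (-S i z / Δ))⁻¹) (𝓝[>] 0)
      (𝓝 ({z | ∀ i, 0 ≤ S i z}.indicator (fun _ => 1) z)) := by
  classical
  have h := tendsto_finsetProd Finset.univ fun i _ => tendsto_logistic_nhdsGT_zero (hz i)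
  rw [Fintype.prod_ite_zero] at h
  simpa [Set.indicator_apply] using h

lemma tendsto_integral_prod_logistic_nhdsGT_zero {α ι : Type*} [MeasurableSpace α] [Fintype ι]
    {μ : Measure α} [IsFiniteMeasure μ] {S : ι → α → ℝ} (hS : ∀ i, Measurable (S i))
    (hnull : ∀ᵐ z ∂μ, ∀ i, S i z ≠ 0) :
    Tendsto (fun Δ : ℝ => ∫ z, ∏ i, (1 + Real.exp (-S i z / Δ))⁻¹ ∂μ) (𝓝[>] 0)
      (𝓝 (μ.real {z | ∀ i, 0 ≤ S i z})) := by
  have hmeas : MeasurableSet {z | ∀ i, 0 ≤ S i z} := by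
    simp only [Set.ofPred_forall]
    exact MeasurableSet.iInter fun i => measurableSet_le measurable_const (hS i)
  have hlim : ∫ z, {z | ∀ i, 0 ≤ S i z}.indicator (fun _ => (1 : ℝ)) z ∂μ =
      μ.real {z | ∀ i, 0 ≤ S i z} := integral_indicator_one hmeas
  rw [← hlim]
  refine tendsto_integral_filter_of_dominated_convergence (fun _ => 1) ?_ ?_
    (integrable_const 1) ?_
  · refine Eventually.of_forall fun Δ => Measurable.aestronglyMeasurable ?_
    fun_prop
  · refine Eventually.of_forall fun Δ => Eventually.of_forall fun z => ?_
    rw [Real.norm_of_nonneg (by positivity)]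
    exact Finset.prod_le_one (fun i _ => by positivity) fun i _ =>
      inv_le_one_of_one_le₀ (le_add_of_nonneg_right (Real.exp_pos _).le)
  · filter_upwards [hnull] with z hz using tendsto_prod_logistic_nhdsGT_zero hz

instance isProbabilityMeasure_stdGaussian_pi (d : ℕ) : IsProbabilityMeasure (stdGaussian d) := by
  unfold _root_.stdGaussian
  infer_instance

/-- For the logistic regularisation function, if the constraint boundaries are `γ`-null and
`γ(A) > 0`, then at every point `z` with `S_ℓ(z) ≠ 0` for all `ℓ`, the smoothed density
converges pointwise to the truncated density as `Δ → 0⁺`: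
`C_Δ⁻¹ ∏_ℓ Λ(S_ℓ(z), Δ) → 1_A(z)/γ(A)`. -/
theorem smoothed_density_pointwise_convergence
    (d s : ℕ) (hd : 1 ≤ d) (hs : 1 ≤ s)
    (S : Fin s → (Fin d → ℝ) → ℝ) (hS : ∀ ℓ, Measurable (S ℓ))
    (A : Set (Fin d → ℝ)) (hA : A = {z | ∀ ℓ : Fin s, 0 ≤ S ℓ z})
    (Λ : ℝ → ℝ → ℝ)
    (hΛ : ∀ x Δ : ℝ, Λ x Δ = (1 + Real.exp (-x / Δ))⁻¹)
    (C : ℝ → ℝ)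
    (hC : ∀ Δ : ℝ, C Δ = ∫ z, (∏ ℓ : Fin s, Λ (S ℓ z) Δ) ∂(stdGaussian d))
    (hnull : stdGaussian d {z | ∃ ℓ : Fin s, S ℓ z = 0} = 0)
    (hApos : 0 < stdGaussian d A)
    (z : Fin d → ℝ) (hz : ∀ ℓ : Fin s, S ℓ z ≠ 0) :
    Tendsto (fun Δ => (C Δ)⁻¹ * ∏ ℓ : Fin s, Λ (S ℓ z) Δ) (𝓝[>] 0)
      (𝓝 (A.indicator (fun _ => (1 : ℝ)) z / (stdGaussian d A).toReal)) := by
  subst hA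
  simp only [hC, hΛ]
  have hae : ∀ᵐ z ∂(stdGaussian d), ∀ ℓ, S ℓ z ≠ 0 := by
    simpa [ae_iff] using hnull
  have hpos : (stdGaussian d).real {z | ∀ ℓ, 0 ≤ S ℓ z} ≠ 0 :=
    (ENNReal.toReal_pos hApos.ne' (measure_ne_top _ _)).ne'
  rw [div_eq_inv_mul]
  exact ((tendsto_integral_prod_logistic_nhdsGT_zero hS hae).inv₀ hpos).mul
    (tendsto_prod_logistic_nhdsGT_zero hz)
end

section
/- Let Λ be the logistic regularisation function. Suppose γ({z ∈ ℝ^d : S_ℓ(z) = 0 for some ℓ}) = 0, γ(A) > 0, and T : ℝ^d → ℝ is γ-integrable. Then lim_{Δ→0⁺} | ∫ T dμ_f − ∫ T dμ_Δ | = 0, i.e. the conclusion of Proposition 1 holds for the logistic regularisation function provided the constraint boundaries are γ-null. -/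
open MeasureTheory ProbabilityTheory Filter Topology Set

/-- The logistic function at scale `Δ` tends to `1` as `Δ → 0⁺` at a positive argument. -/
theorem tendsto_logistic_of_pos {x : ℝ} (hx : 0 < x) :
    Tendsto (fun Δ : ℝ => (1 + Real.exp (-x / Δ))⁻¹) (𝓝[>] 0) (𝓝 1) := by
  have h : Tendsto (fun Δ : ℝ => -x / Δ) (𝓝[>] 0) atBot := by
    simpa only [div_eq_mul_inv] using
      tendsto_inv_nhdsGT_zero.const_mul_atTop_of_neg (neg_lt_zero.2 hx)
  simpa using ((Real.tendsto_exp_atBot.comp h).const_add 1).inv₀ (by norm_num)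

/-- The logistic function at scale `Δ` tends to `0` as `Δ → 0⁺` at a negative argument. -/
theorem tendsto_logistic_of_neg {x : ℝ} (hx : x < 0) :
    Tendsto (fun Δ : ℝ => (1 + Real.exp (-x / Δ))⁻¹) (𝓝[>] 0) (𝓝 0) := by
  have h : Tendsto (fun Δ : ℝ => -x / Δ) (𝓝[>] 0) atTop := by
    simpa only [div_eq_mul_inv] using
      tendsto_inv_nhdsGT_zero.const_mul_atTop (neg_pos.2 hx)
  exact (tendsto_atTop_add_const_left _ 1 (Real.tendsto_exp_atTop.comp h)).inv_tendsto_atTop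

theorem prod_logistic_nonneg {ι : Type*} [Fintype ι] (x : ι → ℝ) (Δ : ℝ) :
    0 ≤ ∏ i, (1 + Real.exp (-x i / Δ))⁻¹ :=
  Finset.prod_nonneg fun _ _ => by positivity

theorem prod_logistic_le_one {ι : Type*} [Fintype ι] (x : ι → ℝ) (Δ : ℝ) :
    ∏ i, (1 + Real.exp (-x i / Δ))⁻¹ ≤ 1 :=
  Finset.prod_le_one (fun _ _ => by positivity) fun i _ =>
    inv_le_one_of_one_le₀ (by linarith [Real.exp_pos (-x i / Δ)])

theorem tendsto_prod_logistic {ι : Type*} [Fintype ι] {x : ι → ℝ} (hx : ∀ i, x i ≠ 0) :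
    Tendsto (fun Δ : ℝ => ∏ i, (1 + Real.exp (-x i / Δ))⁻¹) (𝓝[>] 0)
      (𝓝 ({y : ι → ℝ | ∀ i, 0 ≤ y i}.indicator 1 x)) := by
  by_cases h : ∀ i, 0 ≤ x i
  · rw [indicator_of_mem (by exact h)]
    simpa using tendsto_finsetProd Finset.univ fun i _ =>
      tendsto_logistic_of_pos ((h i).lt_of_ne (hx i).symm)
  · rw [indicator_of_notMem (by exact h)]
    push Not at h
    obtain ⟨j, hj⟩ := h
    have hlim (i : ι) : Tendsto (fun Δ : ℝ => (1 + Real.exp (-x i / Δ))⁻¹) (𝓝[>] 0)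
        (𝓝 (if 0 ≤ x i then 1 else 0)) := by
      split_ifs with hi
      · exact tendsto_logistic_of_pos (hi.lt_of_ne (hx i).symm)
      · exact tendsto_logistic_of_neg (not_le.1 hi)
    have h := tendsto_finsetProd Finset.univ fun i _ => hlim i
    rwa [Finset.prod_eq_zero (Finset.mem_univ j) (if_neg hj.not_ge)] at h

/-- Integrals against a product of logistic weights converge, as the scale tends to `0⁺`, to the
integral over the set where all the arguments are nonnegative, provided the arguments are almost
everywhere nonzero. -/
theorem tendsto_integral_prod_logistic_mul {Ω ι : Type*} [MeasurableSpace Ω] [Fintype ι]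
    {μ : Measure Ω} {S : ι → Ω → ℝ} (hS : ∀ i, Measurable (S i))
    (hne : ∀ᵐ z ∂μ, ∀ i, S i z ≠ 0) {f : Ω → ℝ} (hf : Integrable f μ) :
    Tendsto (fun Δ : ℝ => ∫ z, (∏ i, (1 + Real.exp (-S i z / Δ))⁻¹) * f z ∂μ) (𝓝[>] 0)
      (𝓝 (∫ z in {z | ∀ i, 0 ≤ S i z}, f z ∂μ)) := by
  have hA : MeasurableSet {z | ∀ i, 0 ≤ S i z} := by
    rw [ofPred_forall]
    exact MeasurableSet.iInter fun i => measurableSet_le measurable_const (hS i)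
  rw [← integral_indicator hA]
  refine tendsto_integral_filter_of_dominated_convergence (fun z => ‖f z‖) ?_ ?_ hf.norm ?_
  · refine .of_forall fun Δ => AEStronglyMeasurable.mul ?_ hf.1
    exact Measurable.aestronglyMeasurable (by fun_prop)
  · refine .of_forall fun Δ => .of_forall fun z => ?_
    rw [norm_mul, Real.norm_of_nonneg (prod_logistic_nonneg (S · z) Δ)]
    exact mul_le_of_le_one_left (norm_nonneg _) (prod_logistic_le_one (S · z) Δ)
  · filter_upwards [hne] with z hz
    convert (tendsto_prod_logistic hz).mul_const (f z) using 2
    simp [indicator_apply]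

/-- **Proposition 1 for the logistic regularisation function.** If the constraint boundaries
are `γ`-null, `γ(A) > 0`, and `T` is `γ`-integrable, then the expectation of `T` under the
truncated measure `μf` and under the smoothed measure `μΔ Δ` (built from the logistic
regularisation function) converge to each other as `Δ → 0⁺`. -/
theorem logistic_expectation_convergence
    (d s : ℕ) (hd : 1 ≤ d) (hs : 1 ≤ s)
    (S : Fin s → (Fin d → ℝ) → ℝ) (hS : ∀ ℓ, Measurable (S ℓ))
    (A : Set (Fin d → ℝ)) (hA : A = {z | ∀ ℓ : Fin s, 0 ≤ S ℓ z})
    (Λ : ℝ → ℝ → ℝ)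
    (hΛ : ∀ x Δ : ℝ, Λ x Δ = (1 + Real.exp (-x / Δ))⁻¹)
    (hnull : stdGaussian d {z | ∃ ℓ : Fin s, S ℓ z = 0} = 0)
    (hApos : 0 < stdGaussian d A)
    (T : (Fin d → ℝ) → ℝ) (hT : Integrable T (stdGaussian d))
    (C : ℝ → ℝ)
    (hC : ∀ Δ : ℝ, C Δ = ∫ z, (∏ ℓ : Fin s, Λ (S ℓ z) Δ) ∂(stdGaussian d))
    (μΔ : ℝ → Measure (Fin d → ℝ))
    (hμΔ : ∀ Δ : ℝ, μΔ Δ = (stdGaussian d).withDensity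
      (fun z => ENNReal.ofReal ((C Δ)⁻¹ * ∏ ℓ : Fin s, Λ (S ℓ z) Δ)))
    (μf : Measure (Fin d → ℝ))
    (hμf : μf = (stdGaussian d A)⁻¹ • (stdGaussian d).restrict A) :
    Tendsto (fun Δ => |(∫ z, T z ∂μf) - ∫ z, T z ∂(μΔ Δ)|) (𝓝[>] 0) (𝓝 0) := by
  obtain rfl : Λ = fun x Δ => (1 + Real.exp (-x / Δ))⁻¹ := funext₂ hΛ
  subst hA hμf
  have : IsProbabilityMeasure (stdGaussian d) := by
    unfold _root_.stdGaussian; infer_instance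
  have hne : ∀ᵐ z ∂stdGaussian d, ∀ ℓ, S ℓ z ≠ 0 := by
    simpa [ae_iff] using hnull
  have hClim : Tendsto C (𝓝[>] 0) (𝓝 ((stdGaussian d).real {z | ∀ ℓ, 0 ≤ S ℓ z})) := by
    rw [funext hC]
    simpa using tendsto_integral_prod_logistic_mul hS hne (integrable_const (1 : ℝ))
  have hTlim := tendsto_integral_prod_logistic_mul hS hne hT
  have hCnonneg (Δ : ℝ) : 0 ≤ C Δ := by
    rw [hC]
    exact integral_nonneg fun z => prod_logistic_nonneg (S · z) Δ
  have hsmooth (Δ : ℝ) : ∫ z, T z ∂(μΔ Δ) =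
      (C Δ)⁻¹ * ∫ z, (∏ ℓ, (1 + Real.exp (-S ℓ z / Δ))⁻¹) * T z ∂(stdGaussian d) := by
    rw [hμΔ, integral_withDensity_eq_integral_toReal_smul (by fun_prop) (by simp),
      ← integral_const_mul]
    congr 1 with z
    rw [ENNReal.toReal_ofReal (mul_nonneg (inv_nonneg.2 (hCnonneg Δ))
      (prod_logistic_nonneg (S · z) Δ)), smul_eq_mul, mul_assoc]
  have hpos : (stdGaussian d).real {z | ∀ ℓ, 0 ≤ S ℓ z} ≠ 0 :=
    (ENNReal.toReal_pos hApos.ne' (measure_ne_top _ _)).ne'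
  have hlim := (hClim.inv₀ hpos).mul hTlim
  simp_rw [hsmooth, integral_smul_measure, ENNReal.toReal_inv, smul_eq_mul]
  have hdiff {a : ℝ} {u : ℝ → ℝ} (h : Tendsto u (𝓝[>] 0) (𝓝 a)) :
      Tendsto (fun Δ => |a - u Δ|) (𝓝[>] 0) (𝓝 0) := by
    simpa using (h.const_sub a).abs
  exact hdiff hlim
end

section
/- For every θ ∈ [−π, π], the four sign restrictions σ11·cos θ ≥ 0, σ21·cos θ + σ22·sin θ ≤ 0, −σ11·sin θ ≥ 0, and σ22·cos θ − σ21·sin θ ≥ 0 hold simultaneously if and only if arctan(σ22/σ21) ≤ θ ≤ 0. -/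
open Real

theorem arctan_le_iff_mul_cos_le_sin {x θ : ℝ} (h₁ : -(π / 2) < θ) (h₂ : θ < π / 2) :
    arctan x ≤ θ ↔ x * cos θ ≤ sin θ := by
  rw [← le_div_iff₀ (cos_pos_of_mem_Ioo ⟨h₁, h₂⟩), ← tan_eq_sin_div_cos]
  nth_rewrite 1 [← arctan_tan h₁ h₂]
  exact arctan_strictMono.le_iff_le

theorem mem_Ioo_of_cos_pos {θ : ℝ} (hθ : θ ∈ Set.Icc (-π) π) (h : 0 < cos θ) :
    θ ∈ Set.Ioo (-(π / 2)) (π / 2) := by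
  rw [Set.mem_Ioo, ← abs_lt]
  by_contra! hle
  have := cos_nonpos_of_pi_div_two_le_of_le hle
    ((abs_le.2 hθ).trans (by linarith [pi_pos]))
  rw [cos_abs] at this
  linarith

theorem div_mul_le_iff_sub_nonneg {a b c s : ℝ} (ha : a < 0) :
    b / a * c ≤ s ↔ 0 ≤ b * c - a * s := by
  rw [div_mul_eq_mul_div, div_le_iff_of_neg ha, sub_nonneg, mul_comm s]

/-- In the bivariate SVAR with `Σ_tr = [[σ11, 0], [σ21, σ22]]` (`σ11, σ22 > 0`, `σ21 < 0`) and
rotation matrix `Q(θ)`, for `θ ∈ [−π, π]` the four sign restrictions on `A0⁻¹ = Σ_tr Q(θ)`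
(first column `(+, −)`, second column `(+, +)`) hold if and only if
`arctan(σ22/σ21) ≤ θ ≤ 0`. -/
theorem bivariate_identified_set_sign_restrictions
    (σ11 σ21 σ22 : ℝ) (h11 : 0 < σ11) (h22 : 0 < σ22) (h21 : σ21 < 0)
    (θ : ℝ) (hθ : θ ∈ Set.Icc (-π) π) :
    (0 ≤ σ11 * cos θ ∧
     σ21 * cos θ + σ22 * sin θ ≤ 0 ∧
     0 ≤ -σ11 * sin θ ∧
     0 ≤ σ22 * cos θ - σ21 * sin θ) ↔
    (arctan (σ22 / σ21) ≤ θ ∧ θ ≤ 0) := by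
  constructor
  · rintro ⟨hc, -, hs, hd⟩
    have hc : 0 ≤ cos θ := nonneg_of_mul_nonneg_right hc h11
    have hs : sin θ ≤ 0 := by nlinarith
    have hc : 0 < cos θ := by
      refine hc.lt_of_ne fun h => ?_
      rw [← h] at hd
      have hsin : sin θ = 0 := by nlinarith
      simpa [← h, hsin] using sin_sq_add_cos_sq θ
    obtain ⟨h₁, h₂⟩ := mem_Ioo_of_cos_pos hθ hc
    refine ⟨(arctan_le_iff_mul_cos_le_sin h₁ h₂).2 ((div_mul_le_iff_sub_nonneg h21).2 hd), ?_⟩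
    by_contra! hpos
    linarith [sin_pos_of_pos_of_lt_pi hpos (by linarith)]
  · rintro ⟨ha, hle⟩
    have h₁ : -(π / 2) < θ := (neg_pi_div_two_lt_arctan _).trans_le ha
    have h₂ : θ < π / 2 := by linarith [pi_pos]
    have hc : 0 < cos θ := cos_pos_of_mem_Ioo ⟨h₁, h₂⟩
    have hs : sin θ ≤ 0 := sin_nonpos_of_nonpos_of_neg_pi_le hle hθ.1
    exact ⟨by positivity, by nlinarith, by nlinarith,
      (div_mul_le_iff_sub_nonneg h21).1 ((arctan_le_iff_mul_cos_le_sin h₁ h₂).1 ha)⟩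
end

section
/- Let ω̄ ≥ 0. For every θ ∈ [−π, π], the four sign restrictions σ11·cos θ ≥ 0, σ21·cos θ + σ22·sin θ ≤ 0, −σ11·sin θ ≥ 0, and σ22·cos θ − σ21·sin θ ≥ 0, together with the supply-elasticity bound σ22·cos θ − σ21·sin θ ≤ −ω̄·σ11·sin θ, hold simultaneously if and only if arctan(σ22/σ21) ≤ θ ≤ arctan(σ22/(σ21 − σ11·ω̄)). -/
open Real

/-- On `[-π, π]`, a positive cosine confines the angle to `(-π/2, π/2)`. -/
lemma mem_Ioo_pi_div_two_of_cos_pos {θ : ℝ} (hθ : θ ∈ Set.Icc (-π) π) (hc : 0 < cos θ) :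
    θ ∈ Set.Ioo (-(π / 2)) (π / 2) := by
  rw [← cos_abs] at hc
  refine abs_lt.mp (not_le.mp fun h => hc.not_ge ?_)
  exact cos_nonpos_of_pi_div_two_le_of_le h (by linarith [abs_le.mpr hθ, pi_pos])

lemma arctan_le_iff_le_tan {a θ : ℝ} (hθ : θ ∈ Set.Ioo (-(π / 2)) (π / 2)) :
    arctan a ≤ θ ↔ a ≤ tan θ := by
  conv_lhs => rw [← arctan_tan hθ.1 hθ.2]
  exact arctan_strictMono.le_iff_le

lemma le_arctan_iff_tan_le {a θ : ℝ} (hθ : θ ∈ Set.Ioo (-(π / 2)) (π / 2)) :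
    θ ≤ arctan a ↔ tan θ ≤ a := by
  conv_lhs => rw [← arctan_tan hθ.1 hθ.2]
  exact arctan_strictMono.le_iff_le

/-- In the bivariate SVAR with `Σ_tr = [[σ11, 0], [σ21, σ22]]` (`σ11, σ22 > 0`, `σ21 < 0`) and
rotation matrix `Q(θ)`, for `θ ∈ [−π, π]` and `ω̄ ≥ 0`, the four sign restrictions on
`A0⁻¹ = Σ_tr Q(θ)` together with the supply-elasticity bound
`σ22 cos θ − σ21 sin θ ≤ −ω̄ σ11 sin θ` hold if and only if
`arctan(σ22/σ21) ≤ θ ≤ arctan(σ22/(σ21 − σ11 ω̄))`. -/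
theorem bivariate_identified_set_with_elasticity_bound
    (σ11 σ21 σ22 ω : ℝ) (h11 : 0 < σ11) (h22 : 0 < σ22) (h21 : σ21 < 0) (hω : 0 ≤ ω)
    (θ : ℝ) (hθ : θ ∈ Set.Icc (-π) π) :
    (0 ≤ σ11 * cos θ ∧
     σ21 * cos θ + σ22 * sin θ ≤ 0 ∧
     0 ≤ -σ11 * sin θ ∧
     0 ≤ σ22 * cos θ - σ21 * sin θ ∧
     σ22 * cos θ - σ21 * sin θ ≤ -ω * σ11 * sin θ) ↔
    (arctan (σ22 / σ21) ≤ θ ∧ θ ≤ arctan (σ22 / (σ21 - σ11 * ω))) := by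
  have hd : σ21 - σ11 * ω < 0 := by nlinarith [mul_nonneg h11.le hω]
  constructor
  · rintro ⟨h1, -, h3, h4, h5⟩
    have hs : sin θ ≤ 0 := by nlinarith
    have hc : 0 < cos θ := by
      refine (nonneg_of_mul_nonneg_right h1 h11).lt_of_ne fun h0 => ?_
      have hs0 : sin θ = 0 := by
        rw [← h0] at h4
        nlinarith
      nlinarith [sin_sq_add_cos_sq θ]
    have hI := mem_Ioo_pi_div_two_of_cos_pos hθ hc
    rw [arctan_le_iff_le_tan hI, le_arctan_iff_tan_le hI, tan_eq_sin_div_cos]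
    constructor
    · rw [div_le_iff_of_neg h21, div_mul_eq_mul_div, div_le_iff₀ hc]
      linarith
    · rw [le_div_iff_of_neg hd, div_mul_eq_mul_div, le_div_iff₀ hc]
      linarith
  · rintro ⟨hl, hu⟩
    have hI : θ ∈ Set.Ioo (-(π / 2)) (π / 2) :=
      ⟨(neg_pi_div_two_lt_arctan _).trans_le hl, hu.trans_lt (arctan_lt_pi_div_two _)⟩
    have hc : 0 < cos θ := cos_pos_of_mem_Ioo hI
    rw [arctan_le_iff_le_tan hI, tan_eq_sin_div_cos, div_le_iff_of_neg h21,
      div_mul_eq_mul_div, div_le_iff₀ hc] at hl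
    rw [le_arctan_iff_tan_le hI, tan_eq_sin_div_cos, le_div_iff_of_neg hd,
      div_mul_eq_mul_div, le_div_iff₀ hc] at hu
    have hs : sin θ ≤ 0 := by
      by_contra! h
      nlinarith [mul_pos h22 hc, mul_neg_of_pos_of_neg h hd]
    refine ⟨by positivity, ?_, ?_, by linarith, by linarith⟩
    · nlinarith
    · nlinarith
end

section
/- Let 0 ≤ λ ≤ σ11. For every θ ∈ [−π, π], the conditions σ22·cos θ ≥ σ21·sin θ together with either (cos θ ≥ 0 and −σ11·sin θ ≥ λ) or (cos θ ≤ 0 and σ11·sin θ ≥ λ) hold if and only if θ lies in the union of closed intervals [arctan(σ22/σ21), arcsin(−λ/σ11)] ∪ [π/2, min(π − arcsin(λ/σ11), π + arctan(σ22/σ21))], where an interval [a, b] is understood to be empty whenever a > b. -/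
open Real

theorem sign_normalisation_iff {σ21 σ22 θ : ℝ} (h22 : 0 < σ22) (h21 : σ21 < 0)
    (hθ : θ ∈ Set.Icc (-π) π) :
    σ21 * sin θ ≤ σ22 * cos θ ↔
      arctan (σ22 / σ21) ≤ θ ∧ θ ≤ π + arctan (σ22 / σ21) := by
  obtain ⟨hθl, hθu⟩ := hθ
  have ha : arctan (σ22 / σ21) < 0 := arctan_lt_zero.2 (div_neg_of_pos_of_neg h22 h21)
  have ha' := neg_pi_div_two_lt_arctan (σ22 / σ21)
  have hc := cos_arctan_pos (σ22 / σ21)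
  have ht : σ22 * cos (arctan (σ22 / σ21)) = σ21 * sin (arctan (σ22 / σ21)) := by
    have h := tan_arctan (σ22 / σ21)
    rw [tan_eq_sin_div_cos, div_eq_div_iff hc.ne' h21.ne] at h
    linarith
  generalize arctan (σ22 / σ21) = a at *
  have key : (σ22 * cos θ - σ21 * sin θ) * cos a = -σ21 * sin (θ - a) := by
    rw [sin_sub]
    linear_combination cos θ * ht
  have hpi := pi_pos
  constructor
  · intro h
    have hs : 0 ≤ sin (θ - a) := by
      have : 0 ≤ -σ21 * sin (θ - a) := key ▸ mul_nonneg (by linarith) hc.le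
      exact nonneg_of_mul_nonneg_right this (by linarith)
    constructor
    · by_contra! hlt
      exact absurd (sin_neg_of_neg_of_neg_pi_lt (x := θ - a) (by linarith) (by linarith))
        hs.not_gt
    · by_contra! hlt
      have h1 : 0 < sin (θ - a - π) :=
        sin_pos_of_pos_of_lt_pi (by linarith) (by linarith)
      rw [sin_sub_pi] at h1
      linarith
  · rintro ⟨h1, h2⟩
    have hs : 0 ≤ sin (θ - a) := sin_nonneg_of_nonneg_of_le_pi (by linarith) (by linarith)
    have : 0 ≤ (σ22 * cos θ - σ21 * sin θ) * cos a :=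
      key ▸ mul_nonneg (by linarith) hs
    linarith [nonneg_of_mul_nonneg_left this hc]

/-- In the bivariate SVAR, under the sign normalisation and the restriction that the impact
response of the first variable to the second shock is at least `λ` (with `0 ≤ λ ≤ σ11`),
the identified set for the angle `θ ∈ [−π, π]` is the union of the two closed intervals
`[arctan(σ22/σ21), arcsin(−λ/σ11)]` and
`[π/2, min(π − arcsin(λ/σ11), π + arctan(σ22/σ21))]`
(with an interval `[a, b]` empty when `a > b`). The first disjunct on the left corresponds to
rotation matrices and the second to reflection matrices. -/
theorem bivariate_disconnected_identified_set
    (σ11 σ21 σ22 lam : ℝ) (h11 : 0 < σ11) (h22 : 0 < σ22) (h21 : σ21 < 0)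
    (hlam0 : 0 ≤ lam) (hlam1 : lam ≤ σ11)
    (θ : ℝ) (hθ : θ ∈ Set.Icc (-π) π) :
    (σ21 * sin θ ≤ σ22 * cos θ ∧
      ((0 ≤ cos θ ∧ lam ≤ -σ11 * sin θ) ∨ (cos θ ≤ 0 ∧ lam ≤ σ11 * sin θ))) ↔
    θ ∈ Set.Icc (arctan (σ22 / σ21)) (arcsin (-lam / σ11)) ∪
        Set.Icc (π / 2)
          (min (π - arcsin (lam / σ11)) (π + arctan (σ22 / σ21))) := by
  rw [sign_normalisation_iff h22 h21 hθ]
  obtain ⟨hθl, hθu⟩ := hθ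
  have ha : arctan (σ22 / σ21) < 0 := arctan_lt_zero.2 (div_neg_of_pos_of_neg h22 h21)
  have ha' := neg_pi_div_two_lt_arctan (σ22 / σ21)
  have hpi := pi_pos
  have hb : 0 ≤ arcsin (lam / σ11) := arcsin_nonneg.2 (by positivity)
  have hb' := arcsin_le_pi_div_two (lam / σ11)
  have hsb : σ11 * sin (arcsin (lam / σ11)) = lam := by
    rw [sin_arcsin (by linarith [div_nonneg hlam0 h11.le]) ((div_le_one h11).2 hlam1)]
    field_simp
  rw [neg_div, arcsin_neg]
  generalize arctan (σ22 / σ21) = a at *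
  generalize arcsin (lam / σ11) = b at *
  simp only [Set.mem_union, Set.mem_Icc, le_min_iff]
  constructor
  · rintro ⟨⟨h1, h2⟩, ⟨hc, hs⟩ | ⟨hc, hs⟩⟩
    · left
      have hθ2 : θ ≤ π / 2 := by
        by_contra! h
        exact absurd (cos_neg_of_pi_div_two_lt_of_lt h (by linarith)) hc.not_gt
      refine ⟨h1, ?_⟩
      by_contra! h
      have h3 : sin (-b) < sin θ := sin_lt_sin_of_lt_of_le_pi_div_two (by linarith) hθ2 h
      rw [sin_neg] at h3
      nlinarith
    · right
      have hθ2 : π / 2 ≤ θ := by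
        by_contra! h
        exact absurd (cos_pos_of_mem_Ioo ⟨by linarith, h⟩) hc.not_gt
      refine ⟨hθ2, ?_, h2⟩
      by_contra! h
      have h3 : sin (π - θ) < sin b :=
        sin_lt_sin_of_lt_of_le_pi_div_two (by linarith) hb' (by linarith)
      rw [sin_pi_sub] at h3
      nlinarith
  · rintro (⟨h1, h2⟩ | ⟨h1, h2, h3⟩)
    · refine ⟨⟨h1, by linarith⟩, Or.inl ⟨cos_nonneg_of_mem_Icc ⟨by linarith, by linarith⟩, ?_⟩⟩
      have h3 : sin θ ≤ sin (-b) :=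
        sin_le_sin_of_le_of_le_pi_div_two (by linarith) (by linarith) h2
      rw [sin_neg] at h3
      nlinarith
    · refine ⟨⟨by linarith, h3⟩,
        Or.inr ⟨cos_nonpos_of_pi_div_two_le_of_le h1 (by linarith), ?_⟩⟩
      have h4 : sin b ≤ sin (π - θ) :=
        sin_le_sin_of_le_of_le_pi_div_two (by linarith) (by linarith) (by linarith)
      rw [sin_pi_sub] at h4
      nlinarith
end
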